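/- Assume sin(τ) ≠ 0. Then there is no solution x, y, θ, φ, vₛ, vᵣ, p₁, p₂ of the regular system on a nondegenerate open interval I containing 0 such that vₛ(0) ≠ 0 and p₁(t) = 0 for all t ∈ I. -/

import Mathlib

open Real Set

/-- A solution of the reduced ODE system governing the D-regular constrained variational
trajectories of a disc (mass `m`, radius `R`, spinning inertia `Js`, rolling inertia `Jr`)
rolling without slip on a plane inclined at angle `τ`, on a set `I ⊆ ℝ`. -/
def IsRegularSolution (m g R Js Jr τ : ℝ) (I : Set ℝ)
    (x y θ φ vs vr p₁ p₂ : ℝ → ℝ) : Prop :=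
  ∀ t ∈ I,
    HasDerivAt x (R * Real.cos (θ t) * vr t / Real.sqrt (Jr + m * R ^ 2)) t ∧
    HasDerivAt y (R * Real.sin (θ t) * vr t / Real.sqrt (Jr + m * R ^ 2)) t ∧
    HasDerivAt θ (vs t / Real.sqrt Js) t ∧
    HasDerivAt φ (vr t / Real.sqrt (Jr + m * R ^ 2)) t ∧
    HasDerivAt vs 0 t ∧
    HasDerivAt vr (m * g * R * Real.sin τ * Real.cos (θ t) / Real.sqrt (Jr + m * R ^ 2)) t ∧
    HasDerivAt p₁
      ((Real.sqrt Jr * vs t * p₂ t - 2 * Real.sqrt m * R * vs t * vr t) /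
          (Real.sqrt Js * Real.sqrt (Jr + m * R ^ 2)) -
        Real.sqrt m * g * Real.sin τ * Real.sin (θ t)) t ∧
    HasDerivAt p₂
      (-(Real.sqrt Jr * vs t * p₁ t) / (Real.sqrt Js * Real.sqrt (Jr + m * R ^ 2)) -
        Real.sqrt m * Real.sqrt Jr * g * Real.sin τ * Real.cos (θ t) /
          Real.sqrt (Jr + m * R ^ 2)) t

theorem HasDerivAt.eq_zero_of_eqOn_Ioo {f : ℝ → ℝ} {f' a b t : ℝ} (ht : t ∈ Set.Ioo a b)
    (hf : ∀ s ∈ Set.Ioo a b, f s = 0) (h : HasDerivAt f f' t) : f' = 0 :=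
  h.unique ((hasDerivAt_const t (0 : ℝ)).congr_of_eventuallyEq
    (Filter.eventuallyEq_of_mem (Ioo_mem_nhds ht.1 ht.2) hf))

/-- Differentiating the constraint `p₁ = 0` twice along a regular solution on an inclined plane
gives `vₛ cos θ = 0`. -/
theorem IsRegularSolution.vs_mul_cos_eq_zero {m g R Js Jr τ a b : ℝ}
    {x y θ φ vs vr p₁ p₂ : ℝ → ℝ}
    (hm : 0 < m) (hg : 0 < g) (hJs : 0 < Js) (hJr : 0 < Jr)
    (hsol : IsRegularSolution m g R Js Jr τ (Set.Ioo a b) x y θ φ vs vr p₁ p₂)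
    (hτ : Real.sin τ ≠ 0) (hp1 : ∀ t ∈ Set.Ioo a b, p₁ t = 0) :
    ∀ t ∈ Set.Ioo a b, vs t * Real.cos (θ t) = 0 := by
  intro t ht
  have hp1' : ∀ s ∈ Set.Ioo a b,
      (Real.sqrt Jr * vs s * p₂ s - 2 * Real.sqrt m * R * vs s * vr s) /
          (Real.sqrt Js * Real.sqrt (Jr + m * R ^ 2)) -
        Real.sqrt m * g * Real.sin τ * Real.sin (θ s) = 0 := by
    intro s hs
    obtain ⟨-, -, -, -, -, -, h, -⟩ := hsol s hs
    exact h.eq_zero_of_eqOn_Ioo hs hp1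
  obtain ⟨-, -, hθ, -, hvs, hvr, -, hp2⟩ := hsol t ht
  have key := HasDerivAt.eq_zero_of_eqOn_Ioo ht hp1'
    (((((hvs.const_mul (Real.sqrt Jr)).mul hp2).sub
      ((hvs.const_mul (2 * Real.sqrt m * R)).mul hvr)).div_const _).sub
      (hθ.sin.const_mul _))
  rw [hp1 t ht] at key
  have hα2 : 0 < Jr + m * R ^ 2 := by positivity
  have hα := Real.sqrt_pos.2 hα2
  have hsJs := Real.sqrt_pos.2 hJs
  have hsm := Real.sqrt_pos.2 hm
  generalize Real.sqrt (Jr + m * R ^ 2) = α at *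
  generalize Real.sqrt Js = σ at *
  generalize Real.sqrt Jr = ρ at *
  generalize Real.sqrt m = μ at *
  have hprod : μ * g * Real.sin τ * (ρ ^ 2 + 2 * m * R ^ 2 + α ^ 2) *
      (vs t * Real.cos (θ t)) = 0 := by
    field_simp at key
    refine mul_left_cancel₀ hsJs.ne' ?_
    linear_combination -key
  have hpos : 0 < ρ ^ 2 + 2 * m * R ^ 2 + α ^ 2 := by positivity
  exact (mul_eq_zero.1 hprod).resolve_left (by positivity)

theorem regular_no_invariant_with_vs_ne_zero (m g R Js Jr τ : ℝ)
    (hm : 0 < m) (hg : 0 < g) (hR : 0 < R) (hJs : 0 < Js) (hJr : 0 < Jr)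
    (a b : ℝ) (hI : (0 : ℝ) ∈ Set.Ioo a b)
    (x y θ φ vs vr p₁ p₂ : ℝ → ℝ)
    (hsol : IsRegularSolution m g R Js Jr τ (Set.Ioo a b) x y θ φ vs vr p₁ p₂)
    (hτ : Real.sin τ ≠ 0) (hvs0 : vs 0 ≠ 0) (hp1 : ∀ t ∈ Set.Ioo a b, p₁ t = 0)
    : False := by
  have hcos := hsol.vs_mul_cos_eq_zero hm hg hJs hJr hτ hp1
  obtain ⟨-, -, hθ, -, hvs, -, -, -⟩ := hsol 0 hI
  have hsin := HasDerivAt.eq_zero_of_eqOn_Ioo hI hcos (hvs.mul hθ.cos)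
  have hc : Real.cos (θ 0) = 0 := (mul_eq_zero.1 (hcos 0 hI)).resolve_left hvs0
  have hs : Real.sin (θ 0) = 0 := by
    have hσ := (Real.sqrt_pos.2 hJs).ne'
    simpa [hvs0, hσ] using hsin
  have := Real.sin_sq_add_cos_sq (θ 0)
  simp [hc, hs] at this
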